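/- arXiv:1711.02026 — 2 statements merged into one kernel-verified Lean document; each statement's English description precedes it below -/
import Mathlib

section
/- For real numbers z > 0, p > 0, Q > 0, T > 0, α > 0, P > 0 satisfying T^α < z p Q, one has ∫₀^T (1 − (1 + z p Q r^{−α})^{−P}) r dr = (T²/2) · ( 1 − (2/(αP + 2)) (T^α/(z p Q))^P · ₂F₁(P, P + 2/α; P + 2/α + 1; −T^α/(z p Q)) ). -/
open MeasureTheory

/-- The Gauss hypergeometric series `₂F₁(a, b; c; x) = Σ_{n≥0} (a)_n (b)_n / (c)_n · xⁿ/n!`,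
where `(q)_n` is the (ascending) Pochhammer symbol. -/
noncomputable def gaussHypergeometric (a b c x : ℝ) : ℝ :=
  ∑' n : ℕ,
    ((ascPochhammer ℝ n).eval a * (ascPochhammer ℝ n).eval b / (ascPochhammer ℝ n).eval c)
      * x ^ n / (n.factorial : ℝ)

/-- The binomial series `(1 - x)^(-a) = Σ (a)_n / n! · xⁿ` on the open unit interval. -/
theorem hasSum_ascPochhammer_div_factorial_mul_pow (a : ℝ) {x : ℝ} (hx : |x| < 1) :
    HasSum (fun n : ℕ => (ascPochhammer ℝ n).eval a / (n.factorial : ℝ) * x ^ n)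
      ((1 - x) ^ (-a)) := by
  have hx' : x ∈ Metric.eball (0 : ℝ) 1 := by
    rw [← ENNReal.ofReal_one, Metric.eball_ofReal]
    simpa using hx
  have h := (Real.one_div_one_sub_rpow_hasFPowerSeriesOnBall_zero a).hasSum hx'
  have h1 : 0 ≤ 1 - x := by linarith [(abs_lt.mp hx).2]
  rw [zero_add, one_div, ← Real.rpow_neg h1] at h
  refine h.congr_fun ?_
  intro n
  have hc : (ascPochhammer ℝ n).eval a = (n.factorial : ℝ) * Ring.choose (a + n - 1) n := by
    rw [← Polynomial.ascPochhammer_smeval_eq_eval,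
      ← Ring.factorial_nsmul_multichoose_eq_ascPochhammer, nsmul_eq_mul]
    rw [Ring.choose, show a + n - 1 - n + 1 = a by ring]
  have hn : (n.factorial : ℝ) ≠ 0 := by positivity
  rw [hc, mul_div_cancel_left₀ _ hn]
  simp [mul_comm]

/-- Consecutive Pochhammer symbols: `(b)_n · (b + n) = b · (b + 1)_n`. -/
theorem ascPochhammer_eval_mul_add_natCast (b : ℝ) (n : ℕ) :
    (ascPochhammer ℝ n).eval b * (b + n) = b * (ascPochhammer ℝ n).eval (b + 1) := by
  rw [← ascPochhammer_succ_eval, ascPochhammer_succ_left]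
  simp

theorem integral_Ioc_rpow_mul_self {T s : ℝ} (hT : 0 < T) (hs : 0 < s) :
    ∫ r in Set.Ioc (0 : ℝ) T, r ^ s * r = T ^ s * T ^ 2 / (s + 2) := by
  have h : ∀ r ∈ Set.Ioc (0 : ℝ) T, r ^ s * r = r ^ (s + 1) := fun r hr => by
    rw [Real.rpow_add_one hr.1.ne']
  rw [setIntegral_congr_fun measurableSet_Ioc h, ← intervalIntegral.integral_of_le hT.le,
    integral_rpow (Or.inl (by linarith)), Real.zero_rpow (by linarith),
    show s + 1 + 1 = s + (2 : ℕ) by push_cast; ring, Real.rpow_add_natCast hT.ne']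
  simp

theorem integrableOn_Ioc_rpow_mul_self (T : ℝ) {s : ℝ} (hs : 0 ≤ s) :
    IntegrableOn (fun r : ℝ => r ^ s * r) (Set.Ioc 0 T) :=
  (((Real.continuous_rpow_const hs).mul continuous_id).continuousOn.integrableOn_Icc
    (a := (0 : ℝ)) (b := T)).mono_set Set.Ioc_subset_Icc_self

/-- Termwise integration of the binomial expansion of `(1 + C r^(-α))^(-P) r` in powers of
`r^α / C`. -/
theorem hasSum_integral_one_add_mul_rpow_neg {C T α P : ℝ} (hC : 0 < C) (hT : 0 < T)
    (hα : 0 < α) (hP : 0 < P) (hconv : T ^ α < C) :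
    HasSum (fun n : ℕ => (ascPochhammer ℝ n).eval P / (n.factorial : ℝ) * (-(T ^ α / C)) ^ n *
        ((T ^ α / C) ^ P * T ^ 2 / (α * P + α * n + 2)))
      (∫ r in Set.Ioc (0 : ℝ) T, (1 + C * r ^ (-α)) ^ (-P) * r) := by
  set c : ℕ → ℝ := fun n => (ascPochhammer ℝ n).eval P / (n.factorial : ℝ) with hc
  have hc0 : ∀ n, 0 ≤ c n := fun n => div_nonneg (ascPochhammer_pos n P hP).le (by positivity)
  have hs : ∀ n : ℕ, 0 < α * P + α * n := fun n => by positivity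
  have hsplit : ∀ r : ℝ, 0 < r → ∀ n : ℕ,
      (r ^ α / C) ^ P * (r ^ α / C) ^ n = C ^ (-P) / C ^ n * r ^ (α * P + α * n) := by
    intro r hr n
    rw [Real.div_rpow (by positivity) hC.le, div_pow, ← Real.rpow_natCast (r ^ α),
      ← Real.rpow_mul hr.le, ← Real.rpow_mul hr.le, Real.rpow_add hr, Real.rpow_neg hC.le]
    field_simp
  set F : ℕ → ℝ → ℝ := fun n r =>
    c n * (-1) ^ n * (C ^ (-P) / C ^ n) * (r ^ (α * P + α * n) * r) with hF
  have hFint : ∀ n, Integrable (F n) (volume.restrict (Set.Ioc 0 T)) := fun n =>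
    (integrableOn_Ioc_rpow_mul_self T (hs n).le).const_mul _
  have hval : ∀ n, ∫ r in Set.Ioc (0 : ℝ) T, F n r =
      c n * (-(T ^ α / C)) ^ n * ((T ^ α / C) ^ P * T ^ 2 / (α * P + α * n + 2)) := by
    intro n
    rw [hF, integral_const_mul, integral_Ioc_rpow_mul_self hT (hs n), neg_pow (T ^ α / C)]
    linear_combination (-(c n * (-1) ^ n * T ^ 2 / (α * P + α * n + 2))) * hsplit T hT n
  have hnorm : ∀ n, ∫ r in Set.Ioc (0 : ℝ) T, ‖F n r‖ =
      c n * (T ^ α / C) ^ n * ((T ^ α / C) ^ P * T ^ 2 / (α * P + α * n + 2)) := by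
    intro n
    have h : ∀ r ∈ Set.Ioc (0 : ℝ) T,
        ‖F n r‖ = c n * (C ^ (-P) / C ^ n) * (r ^ (α * P + α * n) * r) := by
      intro r hr
      have hr0 := hr.1
      have h1 : 0 ≤ C ^ (-P) / C ^ n := by positivity
      have h2 : 0 ≤ r ^ (α * P + α * n) * r := by positivity
      simp only [hF, norm_mul, norm_pow, norm_neg, norm_one, one_pow, mul_one,
        Real.norm_of_nonneg (hc0 n), Real.norm_of_nonneg h1]
      rw [← norm_mul, Real.norm_of_nonneg h2]
    rw [setIntegral_congr_fun measurableSet_Ioc h, integral_const_mul,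
      integral_Ioc_rpow_mul_self hT (hs n)]
    linear_combination (-(c n * T ^ 2 / (α * P + α * n + 2))) * hsplit T hT n
  have hu : T ^ α / C < 1 := (div_lt_one hC).mpr hconv
  have hu0 : 0 < T ^ α / C := by positivity
  have hsum : Summable fun n => ∫ r in Set.Ioc (0 : ℝ) T, ‖F n r‖ := by
    simp_rw [hnorm]
    have h := (hasSum_ascPochhammer_div_factorial_mul_pow P
      (by rwa [abs_of_pos hu0] : |T ^ α / C| < 1)).summable
    refine Summable.of_nonneg_of_le (fun n => ?_) (fun n => ?_)
      (h.mul_right ((T ^ α / C) ^ P * T ^ 2 / 2))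
    · have := hs n
      have := hc0 n
      positivity
    · have := hs n
      have := hc0 n
      change c n * _ * _ ≤ c n * _ * _
      gcongr
      linarith
  have hmain := hasSum_integral_of_summable_integral_norm hFint hsum
  simp_rw [hval] at hmain
  convert! hmain using 1
  refine setIntegral_congr_fun measurableSet_Ioc fun r hr => ?_
  have hr0 := hr.1
  have hv0 : 0 < r ^ α / C := div_pos (Real.rpow_pos_of_pos hr0 _) hC
  have hv : r ^ α / C < 1 := by
    refine lt_of_le_of_lt ?_ hu
    gcongr
    exact hr.2
  have hb := hasSum_ascPochhammer_div_factorial_mul_pow P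
    (by rwa [abs_neg, abs_of_pos hv0] : |-(r ^ α / C)| < 1)
  have hbase : (1 + C * r ^ (-α)) ^ (-P) = (r ^ α / C) ^ P * (1 - -(r ^ α / C)) ^ (-P) := by
    rw [show 1 + C * r ^ (-α) = (r ^ α / C)⁻¹ * (1 - -(r ^ α / C)) by
      rw [Real.rpow_neg hr0.le]
      have := (Real.rpow_pos_of_pos hr0 α).ne'
      field_simp
      ring, Real.mul_rpow (by positivity) (by linarith), Real.inv_rpow hv0.le,
      Real.rpow_neg hv0.le, inv_inv]
  change (1 + C * r ^ (-α)) ^ (-P) * r = ∑' n, F n r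
  rw [hbase, mul_right_comm]
  refine ((hb.mul_left ((r ^ α / C) ^ P * r)).congr_fun fun n => ?_).tsum_eq.symm
  rw [neg_pow (r ^ α / C)]
  change c n * _ * _ * _ = _ * (c n * _)
  linear_combination (-(c n * (-1) ^ n * r)) * hsplit r hr0 n

theorem integrableOn_Ioc_one_add_mul_rpow_neg {C α P : ℝ} (hC : 0 < C) (hP : 0 < P) (T : ℝ) :
    IntegrableOn (fun r : ℝ => (1 + C * r ^ (-α)) ^ (-P) * r) (Set.Ioc 0 T) := by
  have hid : IntegrableOn (fun r : ℝ => r) (Set.Ioc 0 T) :=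
    (continuous_id.integrableOn_Icc (a := (0 : ℝ)) (b := T)).mono_set Set.Ioc_subset_Icc_self
  refine Integrable.mono hid ?_ ?_
  · exact Measurable.aestronglyMeasurable (by fun_prop)
  · refine (ae_restrict_iff' measurableSet_Ioc).mpr (ae_of_all _ fun r hr => ?_)
    have hr0 := hr.1
    have h1 : 1 ≤ 1 + C * r ^ (-α) := by
      have : 0 < C * r ^ (-α) := by positivity
      linarith
    have h2 : (1 + C * r ^ (-α)) ^ (-P) ≤ 1 :=
      Real.rpow_le_one_of_one_le_of_nonpos h1 (by linarith)
    have h3 : 0 ≤ (1 + C * r ^ (-α)) ^ (-P) := by positivity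
    rw [norm_mul, Real.norm_of_nonneg h3]
    exact mul_le_of_le_one_left (norm_nonneg _) h2

/-- Closed-form evaluation of the auxiliary integral
`𝓕₁(z, p, α, P, Q, T) = ∫₀^T (1 − (1 + z p Q r^{−α})^{−P}) r dr`
in terms of the Gauss hypergeometric function, valid when `T^α < z p Q`. -/
theorem F1_closed_form
    (z p Q T α P : ℝ) (hz : 0 < z) (hp : 0 < p) (hQ : 0 < Q) (hT : 0 < T)
    (hα : 0 < α) (hP : 0 < P) (hconv : T ^ α < z * p * Q) :
    ∫ r in Set.Ioc (0 : ℝ) T, (1 - (1 + z * p * Q * r ^ (-α)) ^ (-P)) * r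
      = T ^ 2 / 2 *
          (1 - 2 / (α * P + 2) * (T ^ α / (z * p * Q)) ^ P *
            gaussHypergeometric P (P + 2 / α) (P + 2 / α + 1) (-(T ^ α / (z * p * Q)))) := by
  have hC : 0 < z * p * Q := by positivity
  generalize z * p * Q = C at hconv hC ⊢
  have hid : ∫ r in Set.Ioc (0 : ℝ) T, r = T ^ 2 / 2 := by
    rw [← intervalIntegral.integral_of_le hT.le, integral_id]
    ring
  have hid_int : IntegrableOn (fun r : ℝ => r) (Set.Ioc 0 T) :=
    (continuous_id.integrableOn_Icc (a := (0 : ℝ)) (b := T)).mono_set Set.Ioc_subset_Icc_self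
  have hsub : ∫ r in Set.Ioc (0 : ℝ) T, (1 - (1 + C * r ^ (-α)) ^ (-P)) * r =
      T ^ 2 / 2 - ∫ r in Set.Ioc (0 : ℝ) T, (1 + C * r ^ (-α)) ^ (-P) * r := by
    rw [← hid, ← integral_sub hid_int (integrableOn_Ioc_one_add_mul_rpow_neg hC hP T)]
    simp only [sub_mul, one_mul]
  rw [hsub, ← (hasSum_integral_one_add_mul_rpow_neg hC hT hα hP hconv).tsum_eq,
    gaussHypergeometric, mul_sub, mul_one, ← tsum_mul_left, ← tsum_mul_left]
  congr 2
  funext n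
  have hb : 0 < P + 2 / α := by positivity
  have hpoch := ascPochhammer_eval_mul_add_natCast (P + 2 / α) n
  have hden := ascPochhammer_pos n (P + 2 / α + 1) (by linarith)
  have hbn : 0 < P + 2 / α + n := by positivity
  have hratio : (ascPochhammer ℝ n).eval (P + 2 / α) / (ascPochhammer ℝ n).eval (P + 2 / α + 1) =
      (α * P + 2) / (α * P + α * n + 2) := by
    have h : (P + 2 / α) / (P + 2 / α + n) = (α * P + 2) / (α * P + α * n + 2) := by
      field_simp
      ring
    rw [← h, div_eq_div_iff hden.ne' hbn.ne', hpoch]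
  rw [mul_div_assoc ((ascPochhammer ℝ n).eval P), hratio]
  have h1 : α * P + 2 ≠ 0 := by positivity
  have h2 : α * P + α * n + 2 ≠ 0 := by positivity
  field_simp
end

section
/- For real numbers z > 0, p > 0, Q > 0, T > 0, α > 2, P > 0 satisfying z p Q < T^α, one has ∫_T^∞ (1 − (1 + z p Q r^{−α})^{−P}) r dr = (T²/2) · ( ₂F₁(−2/α, P; 1 − 2/α; −z p Q / T^α) − 1 ). -/
open MeasureTheory

theorem ascPochhammer_eval_mul_add (s : ℝ) (n : ℕ) :
    (ascPochhammer ℝ n).eval s * (s + n) = s * (ascPochhammer ℝ n).eval (s + 1) := by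
  rw [← ascPochhammer_succ_eval, ascPochhammer_succ_left]
  simp

/-- The binomial series for a negated exponent, in terms of rising factorials. -/
theorem hasSum_ascPochhammer_mul_neg_pow (P : ℝ) {x : ℝ} (hx : |x| < 1) :
    HasSum (fun n : ℕ => (ascPochhammer ℝ n).eval P / (n.factorial : ℝ) * (-x) ^ n)
      ((1 + x) ^ (-P)) := by
  have hmem : -x ∈ Metric.eball (0 : ℝ) 1 := by
    rw [← ENNReal.ofReal_one, Metric.eball_ofReal]
    simpa using hx
  have h := (Real.one_div_one_sub_rpow_hasFPowerSeriesOnBall_zero P).hasSum hmem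
  rw [Real.rpow_neg (by linarith [neg_lt_of_abs_lt hx])]
  have hcoeff (n : ℕ) : Ring.choose (P + n - 1) n =
      (ascPochhammer ℝ n).eval P / (n.factorial : ℝ) := by
    rw [eq_div_iff (by positivity), ← Polynomial.ascPochhammer_smeval_eq_eval,
      ← Ring.factorial_nsmul_multichoose_eq_ascPochhammer, Ring.choose, nsmul_eq_mul]
    ring_nf
  simpa [hcoeff, mul_comm] using h

theorem rpow_neg_pow_mul_self {r : ℝ} (hr : 0 < r) (α : ℝ) (k : ℕ) :
    (r ^ (-α)) ^ k * r = r ^ (1 - α * k) := by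
  rw [← Real.rpow_natCast, ← Real.rpow_mul hr.le, ← Real.rpow_add_one hr.ne']
  ring_nf

theorem integrableOn_rpow_neg_pow_mul_self {α T : ℝ} (hT : 0 < T) {k : ℕ} (hk : 2 < α * k) :
    IntegrableOn (fun r : ℝ => (r ^ (-α)) ^ k * r) (Set.Ioi T) :=
  (integrableOn_Ioi_rpow_of_lt (by linarith : 1 - α * k < -1) hT).congr_fun
    (fun _ hr => (rpow_neg_pow_mul_self (hT.trans hr) α k).symm) measurableSet_Ioi

theorem integral_rpow_neg_pow_mul_self {α T : ℝ} (hT : 0 < T) {k : ℕ} (hk : 2 < α * k) :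
    ∫ r in Set.Ioi T, (r ^ (-α)) ^ k * r = T ^ 2 / (T ^ α) ^ k / (α * k - 2) := by
  rw [setIntegral_congr_fun measurableSet_Ioi
      (fun _ hr => rpow_neg_pow_mul_self (hT.trans hr) α k),
    integral_Ioi_rpow_of_lt (by linarith) hT,
    show 1 - α * k + 1 = 2 - α * k by ring, Real.rpow_sub hT, Real.rpow_mul hT.le,
    Real.rpow_natCast, Real.rpow_two, ← neg_sub (α * k) 2, neg_div_neg_eq]

/-- Closed-form evaluation of the auxiliary integral
`𝓕₂(z, p, α, P, Q, T) = ∫_T^∞ (1 − (1 + z p Q r^{−α})^{−P}) r dr`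
in terms of the Gauss hypergeometric function, valid when `α > 2` and `z p Q < T^α`. -/
theorem F2_closed_form
    (z p Q T α P : ℝ) (hz : 0 < z) (hp : 0 < p) (hQ : 0 < Q) (hT : 0 < T)
    (hα : 2 < α) (hP : 0 < P) (hconv : z * p * Q < T ^ α) :
    ∫ r in Set.Ioi T, (1 - (1 + z * p * Q * r ^ (-α)) ^ (-P)) * r
      = T ^ 2 / 2 *
          (gaussHypergeometric (-2 / α) P (1 - 2 / α) (-(z * p * Q / T ^ α)) - 1) := by
  set c := z * p * Q
  have hc0 : 0 < c := by positivity
  have hTα : 0 < T ^ α := Real.rpow_pos_of_pos hT α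
  set a : ℕ → ℝ := fun n => (ascPochhammer ℝ n).eval P / (n.factorial : ℝ) with ha
  have ha0 (n : ℕ) : 0 ≤ a n := div_nonneg (ascPochhammer_pos n P hP).le (by positivity)
  have hk (n : ℕ) : α ≤ α * (n + 1 : ℕ) := by
    push_cast
    nlinarith [(n.cast_nonneg : (0 : ℝ) ≤ n)]
  have hk2 (n : ℕ) : 2 < α * (n + 1 : ℕ) := hα.trans_le (hk n)
  set F : ℕ → ℝ → ℝ := fun n r => -(a (n + 1) * (-c) ^ (n + 1)) * ((r ^ (-α)) ^ (n + 1) * r)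
    with hF
  have hFint (n : ℕ) : IntegrableOn (F n) (Set.Ioi T) :=
    (integrableOn_rpow_neg_pow_mul_self hT (hk2 n)).const_mul _
  have hFnorm (n : ℕ) : ∫ r in Set.Ioi T, ‖F n r‖ =
      a (n + 1) * c ^ (n + 1) * (T ^ 2 / (T ^ α) ^ (n + 1) / (α * (n + 1 : ℕ) - 2)) := by
    rw [← integral_rpow_neg_pow_mul_self hT (hk2 n), ← integral_const_mul]
    refine setIntegral_congr_fun measurableSet_Ioi fun r hr => ?_
    have hr0 : 0 < r := hT.trans hr
    have : 0 ≤ (r ^ (-α)) ^ (n + 1) * r := by positivity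
    simp only [hF, norm_mul, norm_neg, norm_pow, Real.norm_of_nonneg this,
      Real.norm_of_nonneg (ha0 _), Real.norm_of_nonneg hc0.le]
  have hx1 : c / T ^ α < 1 := (div_lt_one hTα).2 hconv
  have hx0 : 0 < c / T ^ α := by positivity
  have hsumm : Summable fun n => ∫ r in Set.Ioi T, ‖F n r‖ := by
    have hs : Summable fun n => a n * (c / T ^ α) ^ n := by
      simpa using (hasSum_ascPochhammer_mul_neg_pow P
        (x := -(c / T ^ α)) (by rwa [abs_neg, abs_of_pos hx0])).summable
    refine Summable.of_nonneg_of_le (fun n => integral_nonneg fun r => norm_nonneg _) (fun n => ?_)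
      (((summable_nat_add_iff 1).2 hs).mul_left (T ^ 2 / (α - 2)))
    rw [hFnorm]
    have h2 : 0 < α - 2 := by linarith
    calc _ = a (n + 1) * (c / T ^ α) ^ (n + 1) * T ^ 2 / (α * (n + 1 : ℕ) - 2) := by
          rw [div_pow]; ring
      _ ≤ a (n + 1) * (c / T ^ α) ^ (n + 1) * T ^ 2 / (α - 2) := by
          have := ha0 (n + 1)
          gcongr
          exact hk n
      _ = _ := by ring
  have hmain := hasSum_integral_of_summable_integral_norm hFint hsumm
  have htsum : ∫ r in Set.Ioi T, (∑' n, F n r) =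
      ∫ r in Set.Ioi T, (1 - (1 + c * r ^ (-α)) ^ (-P)) * r := by
    refine setIntegral_congr_fun measurableSet_Ioi fun r hr => HasSum.tsum_eq ?_
    have hr0 : 0 < r := hT.trans hr
    have hlt : c * r ^ (-α) < 1 := by
      rw [Real.rpow_neg hr0.le, ← div_eq_mul_inv, div_lt_one (by positivity)]
      exact hconv.trans (Real.rpow_lt_rpow hT.le hr (by linarith))
    have h := (hasSum_nat_add_iff' 1).2 (hasSum_ascPochhammer_mul_neg_pow P
      (x := c * r ^ (-α)) (by rwa [abs_of_pos (by positivity)]))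
    convert! (h.neg.mul_right r) using 1
    · ext n
      simp only [hF, ha]
      rw [← neg_mul c, mul_pow]
      ring
    · simp
  let g : ℕ → ℝ := fun n =>
    ((ascPochhammer ℝ n).eval (-2 / α) * (ascPochhammer ℝ n).eval P /
      (ascPochhammer ℝ n).eval (1 - 2 / α)) * (-(c / T ^ α)) ^ n / (n.factorial : ℝ)
  have hterm (n : ℕ) : ∫ r in Set.Ioi T, F n r = T ^ 2 / 2 * g (n + 1) := by
    have hpos : 0 < 1 - 2 / α := by
      rw [sub_pos, div_lt_one (by linarith)]
      exact hα
    have hB := ascPochhammer_pos (n + 1) _ hpos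
    have hratio := ascPochhammer_eval_mul_add (-2 / α) (n + 1)
    rw [show -2 / α + 1 = 1 - 2 / α by ring] at hratio
    have hd : α * (n + 1 : ℕ) - 2 ≠ 0 := by linarith [hk2 n]
    have hα0 : α ≠ 0 := by linarith
    have hq : (ascPochhammer ℝ (n + 1)).eval (-2 / α) =
        -2 / (α * (n + 1 : ℕ) - 2) * (ascPochhammer ℝ (n + 1)).eval (1 - 2 / α) := by
      field_simp at hratio ⊢
      linear_combination hratio
    simp only [hF, ha, g]
    rw [integral_const_mul, integral_rpow_neg_pow_mul_self hT (hk2 n), hq, ← neg_div, div_pow]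
    generalize (ascPochhammer ℝ (n + 1)).eval (1 - 2 / α) = B at hB
    field_simp
  rw [htsum] at hmain
  simp only [hterm] at hmain
  have hT2 : T ^ 2 / 2 ≠ 0 := by positivity
  rw [← mul_div_cancel₀ (∫ r in Set.Ioi T, (1 - (1 + c * r ^ (-α)) ^ (-P)) * r) hT2,
    hasSum_mul_left_iff hT2] at hmain
  have hG : gaussHypergeometric (-2 / α) P (1 - 2 / α) (-(c / T ^ α)) = _ :=
    ((hasSum_nat_add_iff (f := g) 1).1 hmain).tsum_eq
  rw [hG]
  simp only [Finset.sum_range_one, g, ascPochhammer_zero, Polynomial.eval_one, pow_zero,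
    Nat.factorial_zero, Nat.cast_one, mul_one, div_one, add_sub_cancel_right]
  rw [mul_div_cancel₀ _ hT2]
end
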